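/- arXiv:math/0110270 — 9 statements merged into one kernel-verified Lean document; each statement's English description precedes it below -/
import Mathlib

section
/- Let A be a commutative ℂ-algebra with an ℕ-grading 𝒜 that is generated in degrees ≤ r for some integer r ≥ 1. Let f, g : A → ℂ be ℂ-algebra homomorphisms and let γ ∈ ℂ be such that f(s) = γ^i · g(s) for every i with 1 ≤ i ≤ r and every s ∈ 𝒜 i. Then for every k ≥ 1 and every s ∈ 𝒜 k one has f(s) = γ^k · g(s). -/
/-- If a graded commutative ℂ-algebra `A` is generated in degrees `≤ r` (`r ≥ 1`),
`f g : A → ℂ` are ℂ-algebra homomorphisms, and `f s = γ ^ i * g s` for every homogeneous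
`s` of degree `i` with `1 ≤ i ≤ r`, then `f s = γ ^ k * g s` for every homogeneous `s`
of degree `k ≥ 1`. -/
theorem stmt0 (A : Type*) [CommRing A] [Algebra ℂ A]
    (𝒜 : ℕ → Submodule ℂ A) [GradedAlgebra 𝒜]
    (r : ℕ) (hr : 1 ≤ r)
    (hgen : Algebra.adjoin ℂ (⋃ i ∈ Set.Icc 1 r, (𝒜 i : Set A)) = ⊤)
    (f g : A →ₐ[ℂ] ℂ) (γ : ℂ)
    (hfg : ∀ i, 1 ≤ i → i ≤ r → ∀ s ∈ 𝒜 i, f s = γ ^ i * g s) :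
    ∀ k, 1 ≤ k → ∀ s ∈ 𝒜 k, f s = γ ^ k * g s := by
  let h : A →ₐ[ℂ] ℂ :=
    (DirectSum.toAlgebra ℂ (fun i => 𝒜 i)
      (fun i => (γ ^ i) • (g.toLinearMap ∘ₗ (𝒜 i).subtype))
      (by simp)
      (by
        intro i j x y
        simp [pow_add]
        ring)).comp
      (DirectSum.decomposeAlgEquiv 𝒜 : A →ₐ[ℂ] DirectSum ℕ fun i => 𝒜 i)
  have hh : ∀ i, ∀ s ∈ 𝒜 i, h s = γ ^ i * g s := by
    intro i s hs
    simp [h, DirectSum.decompose_of_mem 𝒜 hs, DirectSum.toAlgebra_apply]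
    erw [DirectSum.toSemiring_of]
    simp
  have hEq : f = h := by
    apply AlgHom.ext_of_adjoin_eq_top hgen
    intro x hx
    simp only [Set.mem_iUnion] at hx
    obtain ⟨i, hi, hx⟩ := hx
    rw [hfg i hi.1 hi.2 x hx, hh i x hx]
  intro k _ s hs
  rw [hEq, hh k s hs]
end

section
/- Let A be a commutative ℂ-algebra with an ℕ-grading 𝒜 that is generated in degrees ≤ r for some integer r ≥ 1, and let f, g : A → ℂ be ℂ-algebra homomorphisms. Suppose there exists σ ∈ 𝒜 1 with g(σ) ≠ 0, and suppose that for every i with 1 ≤ i ≤ r and every s ∈ 𝒜 i, f(s) = 0 implies g(s) = 0. Then for every k ≥ 1 and every s ∈ 𝒜 k, f(s) = 0 implies g(s) = 0. -/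
/-- If a graded commutative ℂ-algebra `A` is generated in degrees `≤ r` (`r ≥ 1`),
`f g : A → ℂ` are ℂ-algebra homomorphisms, some `σ` of degree `1` has `g σ ≠ 0`, and
for every homogeneous `s` of degree `i` with `1 ≤ i ≤ r` we have `f s = 0 → g s = 0`,
then the same implication holds for every homogeneous `s` of degree `k ≥ 1`. -/
theorem stmt2 (A : Type*) [CommRing A] [Algebra ℂ A]
    (𝒜 : ℕ → Submodule ℂ A) [GradedAlgebra 𝒜]
    (r : ℕ) (hr : 1 ≤ r)
    (hgen : Algebra.adjoin ℂ (⋃ i ∈ Set.Icc 1 r, (𝒜 i : Set A)) = ⊤)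
    (f g : A →ₐ[ℂ] ℂ)
    (hσ : ∃ σ ∈ 𝒜 1, g σ ≠ 0)
    (hsep : ∀ i, 1 ≤ i → i ≤ r → ∀ s ∈ 𝒜 i, f s = 0 → g s = 0) :
    ∀ k, 1 ≤ k → ∀ s ∈ 𝒜 k, f s = 0 → g s = 0 := by
  classical
  obtain ⟨σ, hσ1, hgσ⟩ := hσ
  have hfσ : f σ ≠ 0 := fun h => hgσ (hsep 1 le_rfl hr σ hσ1 h)
  have hbase : ∀ i, 1 ≤ i → i ≤ r → ∀ s ∈ 𝒜 i, g s = (g σ / f σ) ^ i * f s := by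
    intro i h1 h2 s hs
    have hσi : σ ^ i ∈ 𝒜 i := by
      have := SetLike.pow_mem_graded i hσ1
      simpa using this
    have h := hsep i h1 h2 ((f σ) ^ i • s - f s • σ ^ i)
      ((𝒜 i).sub_mem ((𝒜 i).smul_mem _ hs) ((𝒜 i).smul_mem _ hσi))
      (by simp only [map_sub, map_smul, map_pow, smul_eq_mul]; ring)
    simp only [map_sub, map_smul, map_pow, smul_eq_mul] at h
    have hne : f σ ^ i ≠ 0 := pow_ne_zero _ hfσ
    rw [div_pow, div_mul_eq_mul_div, eq_div_iff hne]
    linear_combination h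
  have hall : ∀ a : A, ∀ k, g (DirectSum.decompose 𝒜 a k : A)
      = (g σ / f σ) ^ k * f (DirectSum.decompose 𝒜 a k : A) := by
    intro a
    have ha : a ∈ Algebra.adjoin ℂ (⋃ i ∈ Set.Icc 1 r, (𝒜 i : Set A)) := by
      rw [hgen]; trivial
    induction ha using Algebra.adjoin_induction with
    | mem x hx =>
      intro k
      simp only [Set.mem_iUnion, Set.mem_Icc, SetLike.mem_coe, exists_prop] at hx
      obtain ⟨i, ⟨h1, h2⟩, hx⟩ := hx
      by_cases hik : i = k
      · subst hik
        rw [DirectSum.decompose_of_mem_same 𝒜 hx]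
        exact hbase i h1 h2 x hx
      · rw [DirectSum.decompose_of_mem_ne 𝒜 hx hik]
        simp
    | algebraMap c =>
      intro k
      have hx : algebraMap ℂ A c ∈ 𝒜 0 := SetLike.algebraMap_mem_graded 𝒜 c
      by_cases hik : 0 = k
      · subst hik
        rw [DirectSum.decompose_of_mem_same 𝒜 hx]
        simp
      · rw [DirectSum.decompose_of_mem_ne 𝒜 hx hik]
        simp
    | add x y _ _ hx hy =>
      intro k
      simp only [DirectSum.decompose_add, DirectSum.add_apply, Submodule.coe_add, map_add,
        hx k, hy k]
      ring
    | mul x y _ _ hx hy =>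
      intro k
      rw [DirectSum.decompose_mul, DirectSum.coe_mul_apply, map_sum, map_sum, Finset.mul_sum]
      refine Finset.sum_congr rfl ?_
      intro ij hij
      have hk := (Finset.mem_filter.mp hij).2
      rw [map_mul, map_mul, hx, hy, ← hk, pow_add]
      ring
  intro k _ s hs hf
  have h := hall s k
  rw [DirectSum.decompose_of_mem_same 𝒜 hs, hf, mul_zero] at h
  exact h
end

section
/- Let A be a commutative ℂ-algebra with an ℕ-grading 𝒜 that is generated in degrees ≤ r for some integer r ≥ 1, let f : A → ℂ be a ℂ-algebra homomorphism, let D : A → ℂ be an f-derivation, and let η ∈ ℂ be such that D(s) = i · η · f(s) for every i with 1 ≤ i ≤ r and every s ∈ 𝒜 i. Then for every k ≥ 1 and every s ∈ 𝒜 k one has D(s) = k · η · f(s). -/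
/-- If a graded commutative ℂ-algebra `A` is generated in degrees `≤ r` (`r ≥ 1`),
`f : A → ℂ` is a ℂ-algebra homomorphism, `D : A → ℂ` is an `f`-derivation
(`D (a*b) = D a * f b + f a * D b`), and `D s = i * η * f s` for every homogeneous `s`
of degree `i` with `1 ≤ i ≤ r`, then `D s = k * η * f s` for every homogeneous `s`
of degree `k ≥ 1`. -/
theorem stmt3 (A : Type*) [CommRing A] [Algebra ℂ A]
    (𝒜 : ℕ → Submodule ℂ A) [GradedAlgebra 𝒜]
    (r : ℕ) (hr : 1 ≤ r)
    (hgen : Algebra.adjoin ℂ (⋃ i ∈ Set.Icc 1 r, (𝒜 i : Set A)) = ⊤)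
    (f : A →ₐ[ℂ] ℂ) (D : A →ₗ[ℂ] ℂ)
    (hD : ∀ a b : A, D (a * b) = D a * f b + f a * D b)
    (η : ℂ)
    (hDη : ∀ i, 1 ≤ i → i ≤ r → ∀ s ∈ 𝒜 i, D s = (i : ℂ) * η * f s) :
    ∀ k, 1 ≤ k → ∀ s ∈ 𝒜 k, D s = (k : ℂ) * η * f s := by
  have hD1 : D 1 = 0 := by
    have h := hD 1 1
    simp only [mul_one, map_one, one_mul] at h
    linear_combination -h
  have hmon : ∀ x ∈ Submonoid.closure (⋃ i ∈ Set.Icc 1 r, (𝒜 i : Set A)),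
      ∃ n : ℕ, x ∈ 𝒜 n ∧ D x = (n : ℂ) * η * f x := by
    intro x hx
    induction hx using Submonoid.closure_induction with
    | mem x hx =>
      simp only [Set.mem_iUnion, Set.mem_Icc, SetLike.mem_coe] at hx
      obtain ⟨i, ⟨h1, h2⟩, hx⟩ := hx
      exact ⟨i, hx, hDη i h1 h2 x hx⟩
    | one => exact ⟨0, SetLike.GradedOne.one_mem, by simp [hD1]⟩
    | mul x y _ _ hx hy =>
      obtain ⟨m, hm, hxm⟩ := hx
      obtain ⟨n, hn, hyn⟩ := hy
      refine ⟨m + n, SetLike.GradedMul.mul_mem hm hn, ?_⟩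
      rw [hD, hxm, hyn, map_mul]
      push_cast
      ring
  have key : ∀ x : A, ∀ k : ℕ, D (DirectSum.decompose 𝒜 x k : A)
      = (k : ℂ) * η * f (DirectSum.decompose 𝒜 x k : A) := by
    intro x
    have hx : x ∈ Submodule.span ℂ
        (Submonoid.closure (⋃ i ∈ Set.Icc 1 r, (𝒜 i : Set A)) : Set A) := by
      rw [← Algebra.adjoin_eq_span, hgen]
      trivial
    induction hx using Submodule.span_induction with
    | mem x hx =>
      intro k
      obtain ⟨n, hn, hxn⟩ := hmon x hx
      by_cases h : n = k
      · subst h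
        rw [DirectSum.decompose_of_mem_same 𝒜 hn, hxn]
      · rw [DirectSum.decompose_of_mem_ne 𝒜 hn h]
        simp
    | zero => intro k; simp
    | add x y _ _ hx hy =>
      intro k
      simp only [DirectSum.decompose_add, DirectSum.add_apply, Submodule.coe_add, map_add, hx k, hy k]
      ring
    | smul c x _ hx =>
      intro k
      simp only [DirectSum.decompose_smul, DirectSum.smul_apply, Submodule.coe_smul, map_smul,
        hx k, smul_eq_mul]
      ring
  intro k _ s hs
  have h := key s k
  rwa [DirectSum.decompose_of_mem_same 𝒜 hs] at h
end

section
/- Let A be a commutative ℂ-algebra with an ℕ-grading 𝒜 that is generated in degrees ≤ r for some integer r ≥ 1, let f : A → ℂ be a ℂ-algebra homomorphism, and let D : A → ℂ be an f-derivation. Suppose there exists σ ∈ 𝒜 1 with f(σ) ≠ 0, and suppose that for every i with 1 ≤ i ≤ r and every s ∈ 𝒜 i, f(s) = 0 implies D(s) = 0. Then for every k ≥ 1 and every s ∈ 𝒜 k, f(s) = 0 implies D(s) = 0. -/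
/-- If a graded commutative ℂ-algebra `A` is generated in degrees `≤ r` (`r ≥ 1`),
`f : A → ℂ` is a ℂ-algebra homomorphism, `D : A → ℂ` is an `f`-derivation, some `σ`
of degree `1` has `f σ ≠ 0`, and for every homogeneous `s` of degree `i` with
`1 ≤ i ≤ r` we have `f s = 0 → D s = 0`, then the same implication holds for every
homogeneous `s` of degree `k ≥ 1`. -/
theorem stmt5 (A : Type*) [CommRing A] [Algebra ℂ A]
    (𝒜 : ℕ → Submodule ℂ A) [GradedAlgebra 𝒜]
    (r : ℕ) (hr : 1 ≤ r)
    (hgen : Algebra.adjoin ℂ (⋃ i ∈ Set.Icc 1 r, (𝒜 i : Set A)) = ⊤)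
    (f : A →ₐ[ℂ] ℂ) (D : A →ₗ[ℂ] ℂ)
    (hD : ∀ a b : A, D (a * b) = D a * f b + f a * D b)
    (hσ : ∃ σ ∈ 𝒜 1, f σ ≠ 0)
    (hsep : ∀ i, 1 ≤ i → i ≤ r → ∀ s ∈ 𝒜 i, f s = 0 → D s = 0) :
    ∀ k, 1 ≤ k → ∀ s ∈ 𝒜 k, f s = 0 → D s = 0 := by
  obtain ⟨σ, hσ1, hσ0⟩ := hσ
  obtain ⟨c, hc⟩ : ∃ c : ℂ, D σ = c * f σ := ⟨D σ / f σ, by field_simp⟩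
  have hD1 : D 1 = 0 := by
    have := hD 1 1
    simp only [mul_one, map_one, one_mul] at this
    linear_combination -this
  have hpow : ∀ n : ℕ, D (σ ^ n) = n * c * f (σ ^ n) := by
    intro n
    induction n with
    | zero => simp [hD1]
    | succ n ih =>
      rw [pow_succ, hD, ih, hc, map_mul]
      push_cast
      ring
  have hlow : ∀ i, 1 ≤ i → i ≤ r → ∀ s ∈ 𝒜 i, D s = i * c * f s := by
    intro i h1 h2 s hs
    have hne : f σ ^ i ≠ 0 := pow_ne_zero _ hσ0
    have hm : σ ^ i ∈ 𝒜 i := by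
      simpa using SetLike.pow_mem_graded i hσ1
    have h := hsep i h1 h2 (s - (f s / f σ ^ i) • σ ^ i)
      (Submodule.sub_mem _ hs (Submodule.smul_mem _ _ hm))
      (by simp only [map_sub, map_smul, map_pow, smul_eq_mul]; field_simp; ring)
    rw [map_sub, map_smul, hpow, map_pow, smul_eq_mul] at h
    have h3 : f s / f σ ^ i * (i * c * f σ ^ i) = i * c * f s := by field_simp
    rw [h3] at h
    exact sub_eq_zero.mp h
  have key : ∀ a : A, ∀ i : ℕ, D (DirectSum.decompose 𝒜 a i : A)
      = i * c * f (DirectSum.decompose 𝒜 a i : A) := by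
    intro a
    have ha : a ∈ Algebra.adjoin ℂ (⋃ i ∈ Set.Icc 1 r, (𝒜 i : Set A)) := by
      rw [hgen]; trivial
    induction ha using Algebra.adjoin_induction with
    | mem x hx =>
      intro i
      simp only [Set.mem_iUnion] at hx
      obtain ⟨j, hj, hx⟩ := hx
      by_cases hij : j = i
      · subst hij
        rw [DirectSum.decompose_of_mem_same 𝒜 hx]
        exact hlow j hj.1 hj.2 x hx
      · rw [DirectSum.decompose_of_mem_ne 𝒜 hx hij]
        simp
    | algebraMap z =>
      intro i
      have hx : algebraMap ℂ A z ∈ 𝒜 0 := SetLike.algebraMap_mem_graded 𝒜 z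
      by_cases hij : 0 = i
      · subst hij
        rw [DirectSum.decompose_of_mem_same 𝒜 hx, Algebra.algebraMap_eq_smul_one]
        simp [hD1]
      · rw [DirectSum.decompose_of_mem_ne 𝒜 hx hij]
        simp
    | add x y _ _ hx hy =>
      intro i
      rw [DirectSum.decompose_add, DirectSum.add_apply, Submodule.coe_add, map_add, map_add,
        hx, hy]
      ring
    | mul x y _ _ hx hy =>
      intro i
      classical
      rw [DirectSum.decompose_mul, DirectSum.coe_mul_apply, map_sum, map_sum, Finset.mul_sum]
      refine Finset.sum_congr rfl fun p hp => ?_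
      have hpi : p.1 + p.2 = i := (Finset.mem_filter.mp hp).2
      rw [hD, hx, hy, map_mul, ← hpi]
      push_cast
      ring
  intro k _ s hs h0
  have := key s k
  rwa [DirectSum.decompose_of_mem_same 𝒜 hs, h0, mul_zero] at this
end

section
/- Let A be a commutative ℂ-algebra with an ℕ-grading 𝒜 such that A equals the ℂ-subalgebra generated by 𝒜 1 ∪ 𝒜 2. Let f : A → ℂ be a ℂ-algebra homomorphism with f(s) = 0 for every s ∈ 𝒜 1. Then f(s) = 0 for every odd k and every s ∈ 𝒜 k. -/
/-- Let `A` be a graded commutative ℂ-algebra generated (as ℂ-algebra) by `𝒜 1 ∪ 𝒜 2`,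
and `f : A → ℂ` a ℂ-algebra homomorphism vanishing on `𝒜 1`. Then `f` vanishes on
`𝒜 k` for every odd `k`. -/
theorem stmt6 (A : Type*) [CommRing A] [Algebra ℂ A]
    (𝒜 : ℕ → Submodule ℂ A) [GradedAlgebra 𝒜]
    (hgen : Algebra.adjoin ℂ ((𝒜 1 : Set A) ∪ (𝒜 2 : Set A)) = ⊤)
    (f : A →ₐ[ℂ] ℂ)
    (hf1 : ∀ s ∈ 𝒜 1, f s = 0) :
    ∀ k, Odd k → ∀ s ∈ 𝒜 k, f s = 0 := by
  classical
  have key : ∀ a : A, ∀ k, Odd k → f (DirectSum.decompose 𝒜 a k : A) = 0 := by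
    intro a
    have ha : a ∈ Algebra.adjoin ℂ ((𝒜 1 : Set A) ∪ (𝒜 2 : Set A)) := by
      rw [hgen]; trivial
    induction ha using Algebra.adjoin_induction with
    | mem x hx =>
      intro k hk
      rcases hx with hx | hx
      · by_cases h : 1 = k
        · subst h
          rw [DirectSum.decompose_of_mem_same 𝒜 hx]
          exact hf1 x hx
        · rw [DirectSum.decompose_of_mem_ne 𝒜 hx h, map_zero]
      · have h : 2 ≠ k := by
          rintro rfl
          exact absurd hk (by decide)
        rw [DirectSum.decompose_of_mem_ne 𝒜 hx h, map_zero]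
    | algebraMap r =>
      intro k hk
      have h : 0 ≠ k := by
        rintro rfl
        exact absurd hk (by decide)
      rw [DirectSum.decompose_of_mem_ne 𝒜 (SetLike.algebraMap_mem_graded 𝒜 r) h, map_zero]
    | add x y _ _ hx hy =>
      intro k hk
      simp [DirectSum.decompose_add, hx k hk, hy k hk]
    | mul x y _ _ hx hy =>
      intro k hk
      rw [DirectSum.decompose_mul, DirectSum.coe_mul_apply, map_sum]
      refine Finset.sum_eq_zero fun ij hij => ?_
      have hs : ij.1 + ij.2 = k := (Finset.mem_filter.mp hij).2
      rw [map_mul]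
      rcases Nat.even_or_odd ij.1 with h1 | h1
      · have h2 : Odd ij.2 := by
          rw [← hs] at hk
          exact (Nat.odd_add'.mp hk).mpr h1
        rw [hy _ h2, mul_zero]
      · rw [hx _ h1, zero_mul]
  intro k hk s hs
  have := key s k hk
  rwa [DirectSum.decompose_of_mem_same 𝒜 hs] at this
end

section
/- Let A be a commutative ℂ-algebra with an ℕ-grading 𝒜 such that A equals the ℂ-subalgebra generated by 𝒜 1 ∪ 𝒜 2. Let f : A → ℂ be a ℂ-algebra homomorphism with f(s) = 0 for every s ∈ 𝒜 1, let D : A → ℂ be an f-derivation, and let η ∈ ℂ be such that D(s) = η · f(s) for every s ∈ 𝒜 2. Then for every m ≥ 1 and every s ∈ 𝒜 (2m) one has D(s) = m · η · f(s). -/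
/-- Let `A` be a graded commutative ℂ-algebra generated (as ℂ-algebra) by `𝒜 1 ∪ 𝒜 2`,
`f : A → ℂ` a ℂ-algebra homomorphism vanishing on `𝒜 1`, `D : A → ℂ` an `f`-derivation,
and `η ∈ ℂ` with `D s = η * f s` for every `s ∈ 𝒜 2`. Then `D s = m * η * f s` for
every `m ≥ 1` and every `s ∈ 𝒜 (2 * m)`. -/
theorem stmt7 (A : Type*) [CommRing A] [Algebra ℂ A]
    (𝒜 : ℕ → Submodule ℂ A) [GradedAlgebra 𝒜]
    (hgen : Algebra.adjoin ℂ ((𝒜 1 : Set A) ∪ (𝒜 2 : Set A)) = ⊤)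
    (f : A →ₐ[ℂ] ℂ)
    (hf1 : ∀ s ∈ 𝒜 1, f s = 0)
    (D : A →ₗ[ℂ] ℂ)
    (hD : ∀ a b : A, D (a * b) = D a * f b + f a * D b)
    (η : ℂ)
    (hD2 : ∀ s ∈ 𝒜 2, D s = η * f s) :
    ∀ m, 1 ≤ m → ∀ s ∈ 𝒜 (2 * m), D s = (m : ℂ) * η * f s := by
  let Q : ℕ → A → Prop := fun n x =>
    (Even n → 2 * D x = (n : ℂ) * η * f x) ∧ (Odd n → f x = 0)
  have hD1 : D 1 = 0 := by
    have h := hD 1 1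
    simp only [mul_one, map_one, one_mul] at h
    simpa using h
  have hmon : ∀ x ∈ Submonoid.closure ((𝒜 1 : Set A) ∪ (𝒜 2 : Set A)),
      ∃ n, x ∈ 𝒜 n ∧ Q n x := by
    intro x hx
    induction hx using Submonoid.closure_induction with
    | mem x hx =>
      rcases hx with hx | hx
      · exact ⟨1, hx, fun h => absurd h (by decide), fun _ => hf1 x hx⟩
      · refine ⟨2, hx, fun _ => ?_, fun h => absurd h (by decide)⟩
        rw [hD2 x hx]
        push_cast
        ring
    | one =>
      exact ⟨0, SetLike.GradedOne.one_mem, fun _ => by simp [hD1],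
        fun h => absurd h (by decide)⟩
    | mul x y _ _ ihx ihy =>
      obtain ⟨a, hxa, hx1, hx2⟩ := ihx
      obtain ⟨b, hyb, hy1, hy2⟩ := ihy
      refine ⟨a + b, SetLike.mul_mem_graded hxa hyb, ?_, ?_⟩
      · intro h
        rw [hD, map_mul]
        push_cast
        rcases Nat.even_or_odd a with ha | ha
        · have hb : Even b := (Nat.even_add.mp h).mp ha
          linear_combination f y * hx1 ha + f x * hy1 hb
        · have hb : Odd b := by
            rw [← Nat.not_even_iff_odd] at ha ⊢
            exact fun hb => ha ((Nat.even_add.mp h).mpr hb)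
          rw [hx2 ha, hy2 hb]
          ring
      · intro h
        rw [map_mul]
        rcases Nat.even_or_odd a with ha | ha
        · have hb : Odd b := (Nat.odd_add'.mp h).mpr ha
          rw [hy2 hb, mul_zero]
        · rw [hx2 ha, zero_mul]
  have hall : ∀ x : A, ∀ n, Q n (GradedRing.proj 𝒜 n x) := by
    intro x
    have hx : x ∈ Submodule.span ℂ
        (Submonoid.closure ((𝒜 1 : Set A) ∪ (𝒜 2 : Set A)) : Set A) := by
      rw [← Algebra.adjoin_eq_span, hgen]
      trivial
    induction hx using Submodule.span_induction with
    | mem x hx =>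
      intro n
      obtain ⟨a, hxa, hq⟩ := hmon x hx
      rw [GradedRing.proj_apply]
      by_cases h : a = n
      · subst h
        rwa [DirectSum.decompose_of_mem_same 𝒜 hxa]
      · rw [DirectSum.decompose_of_mem_ne 𝒜 hxa h]
        exact ⟨fun _ => by simp, fun _ => by simp⟩
    | zero => exact fun n => ⟨fun _ => by simp, fun _ => by simp⟩
    | add x y _ _ ihx ihy =>
      intro n
      rw [map_add]
      refine ⟨fun h => ?_, fun h => ?_⟩
      · rw [map_add, map_add]
        linear_combination (ihx n).1 h + (ihy n).1 h
      · rw [map_add, (ihx n).2 h, (ihy n).2 h, add_zero]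
    | smul c x _ ih =>
      intro n
      have e : GradedRing.proj 𝒜 n (c • x) = c • GradedRing.proj 𝒜 n x := by
        rw [GradedRing.proj_apply, GradedRing.proj_apply, DirectSum.decompose_smul]
        rfl
      rw [e]
      refine ⟨fun h => ?_, fun h => ?_⟩
      · rw [map_smul, map_smul, smul_eq_mul, smul_eq_mul]
        linear_combination c * (ih n).1 h
      · rw [map_smul, (ih n).2 h, smul_zero]
  intro m _ s hs
  have h := (hall s (2 * m)).1 (even_two_mul m)
  rw [GradedRing.proj_apply, DirectSum.decompose_of_mem_same 𝒜 hs] at h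
  push_cast at h
  linear_combination h / 2
end

section
/- Let A be a commutative ℂ-algebra with an ℕ-grading 𝒜 such that A equals the ℂ-subalgebra generated by 𝒜 1 ∪ 𝒜 2. Let f : A → ℂ be a ℂ-algebra homomorphism with f(s) = 0 for every s ∈ 𝒜 2. Then f(s) = 0 for every k ≥ 1 and every s ∈ 𝒜 k. -/
/-- Let `A` be a graded commutative ℂ-algebra generated (as ℂ-algebra) by `𝒜 1 ∪ 𝒜 2`,
and `f : A → ℂ` a ℂ-algebra homomorphism vanishing on `𝒜 2`. Then `f` vanishes on
`𝒜 k` for every `k ≥ 1`. -/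
theorem stmt8 (A : Type*) [CommRing A] [Algebra ℂ A]
    (𝒜 : ℕ → Submodule ℂ A) [GradedAlgebra 𝒜]
    (hgen : Algebra.adjoin ℂ ((𝒜 1 : Set A) ∪ (𝒜 2 : Set A)) = ⊤)
    (f : A →ₐ[ℂ] ℂ)
    (hf2 : ∀ s ∈ 𝒜 2, f s = 0) :
    ∀ k, 1 ≤ k → ∀ s ∈ 𝒜 k, f s = 0 := by
  have hf1 : ∀ s ∈ 𝒜 1, f s = 0 := by
    intro s hs
    have h : s * s ∈ 𝒜 (1 + 1) := SetLike.mul_mem_graded hs hs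
    have h2 := hf2 _ h
    rw [map_mul] at h2
    exact mul_self_eq_zero.mp h2
  have hz : ∀ k, 1 ≤ k → ∀ s ∈ 𝒜 k, GradedRing.projZeroRingHom 𝒜 s = 0 := by
    intro k hk s hs
    rw [GradedRing.projZeroRingHom_apply]
    exact DirectSum.decompose_of_mem_ne 𝒜 hs (by omega)
  have key : ∀ x : A, f x = f (GradedRing.projZeroRingHom 𝒜 x) := by
    intro x
    have hx : x ∈ Algebra.adjoin ℂ ((𝒜 1 : Set A) ∪ (𝒜 2 : Set A)) := by
      rw [hgen]; trivial
    induction hx using Algebra.adjoin_induction with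
    | mem x hx =>
      rcases hx with hx | hx
      · rw [hz 1 le_rfl x hx, hf1 x hx, map_zero]
      · rw [hz 2 (by norm_num) x hx, hf2 x hx, map_zero]
    | algebraMap r =>
      congr 1
      rw [GradedRing.projZeroRingHom_apply]
      exact (DirectSum.decompose_of_mem_same 𝒜 (SetLike.algebraMap_mem_graded 𝒜 r)).symm
    | add x y _ _ hx hy => rw [map_add, map_add, map_add, hx, hy]
    | mul x y _ _ hx hy => rw [map_mul, map_mul, map_mul, hx, hy]
  intro k hk s hs
  rw [key, hz k hk s hs, map_zero]
end

section
/- Let A be a commutative ℂ-algebra with an ℕ-grading 𝒜 such that A equals the ℂ-subalgebra generated by 𝒜 1 ∪ 𝒜 2. Let f, g : A → ℂ be ℂ-algebra homomorphisms that both vanish identically on 𝒜 1, and let γ ∈ ℂ be such that f(s) = γ · g(s) for every s ∈ 𝒜 2. Then for every m ≥ 1 and every s ∈ 𝒜 (2m) one has f(s) = γ^m · g(s). -/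
/-- Let `A` be a graded commutative ℂ-algebra generated (as ℂ-algebra) by `𝒜 1 ∪ 𝒜 2`,
`f g : A → ℂ` ℂ-algebra homomorphisms both vanishing on `𝒜 1`, and `γ ∈ ℂ` with
`f s = γ * g s` for every `s ∈ 𝒜 2`. Then `f s = γ ^ m * g s` for every `m ≥ 1` and
every `s ∈ 𝒜 (2 * m)`. -/
theorem stmt9 (A : Type*) [CommRing A] [Algebra ℂ A]
    (𝒜 : ℕ → Submodule ℂ A) [GradedAlgebra 𝒜]
    (hgen : Algebra.adjoin ℂ ((𝒜 1 : Set A) ∪ (𝒜 2 : Set A)) = ⊤)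
    (f g : A →ₐ[ℂ] ℂ)
    (hf1 : ∀ s ∈ 𝒜 1, f s = 0) (hg1 : ∀ s ∈ 𝒜 1, g s = 0)
    (γ : ℂ)
    (hfg2 : ∀ s ∈ 𝒜 2, f s = γ * g s) :
    ∀ m, 1 ≤ m → ∀ s ∈ 𝒜 (2 * m), f s = γ ^ m * g s := by
  classical
  let P : ℕ → A → Prop := fun n x =>
    (∀ k, n = 2 * k + 1 → f x = 0 ∧ g x = 0) ∧ (∀ k, n = 2 * k → f x = γ ^ k * g x)
  have hP0 : ∀ n, P n 0 := fun n => ⟨fun k _ => by simp, fun k _ => by simp⟩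
  have hmon : ∀ x ∈ Submonoid.closure ((𝒜 1 : Set A) ∪ (𝒜 2 : Set A)),
      ∃ n, x ∈ 𝒜 n ∧ P n x := by
    intro x hx
    induction hx using Submonoid.closure_induction with
    | mem x hx =>
      rcases hx with hx | hx
      · exact ⟨1, hx, fun k _ => ⟨hf1 x hx, hg1 x hx⟩, fun k hk => by omega⟩
      · refine ⟨2, hx, fun k hk => by omega, fun k hk => ?_⟩
        obtain rfl : k = 1 := by omega
        simpa using hfg2 x hx
    | one =>
      refine ⟨0, SetLike.GradedOne.one_mem, fun k hk => by omega, fun k hk => ?_⟩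
      obtain rfl : k = 0 := by omega
      simp
    | mul x y _ _ ihx ihy =>
      obtain ⟨i, hxi, hx1, hx2⟩ := ihx
      obtain ⟨j, hyj, hy1, hy2⟩ := ihy
      refine ⟨i + j, SetLike.GradedMul.mul_mem hxi hyj, ?_⟩
      obtain ⟨a, ha | ha⟩ := Nat.even_or_odd' i
      · obtain ⟨b, hb | hb⟩ := Nat.even_or_odd' j
        · refine ⟨fun k hk => by omega, fun k hk => ?_⟩
          obtain rfl : k = a + b := by omega
          rw [map_mul, map_mul, hx2 a ha, hy2 b hb, pow_add]
          ring
        · obtain ⟨h1, h2⟩ := hy1 b hb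
          exact ⟨fun k _ => by simp [h1, h2], fun k _ => by simp [h1, h2]⟩
      · obtain ⟨h1, h2⟩ := hx1 a ha
        exact ⟨fun k _ => by simp [h1, h2], fun k _ => by simp [h1, h2]⟩
  have hall : ∀ x : A, ∀ n, P n (DirectSum.decompose 𝒜 x n : A) := by
    intro x
    have hx : x ∈ Submodule.span ℂ
        (Submonoid.closure ((𝒜 1 : Set A) ∪ (𝒜 2 : Set A)) : Set A) := by
      rw [← Algebra.adjoin_eq_span, hgen]
      trivial
    induction hx using Submodule.span_induction with
    | mem x hx =>
      intro n
      obtain ⟨i, hi, hp⟩ := hmon x hx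
      by_cases h : i = n
      · subst h
        rwa [DirectSum.decompose_of_mem_same 𝒜 hi]
      · rw [DirectSum.decompose_of_mem_ne 𝒜 hi h]
        exact hP0 n
    | zero => intro n; simpa using hP0 n
    | add x y _ _ ihx ihy =>
      intro n
      rw [DirectSum.decompose_add, DirectSum.add_apply, Submodule.coe_add]
      refine ⟨fun k hk => ?_, fun k hk => ?_⟩
      · simp [(ihx n).1 k hk, (ihy n).1 k hk]
      · rw [map_add, map_add, (ihx n).2 k hk, (ihy n).2 k hk, mul_add]
    | smul c x _ ih =>
      intro n
      rw [DirectSum.decompose_smul, DirectSum.smul_apply, Submodule.coe_smul]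
      refine ⟨fun k hk => ?_, fun k hk => ?_⟩
      · simp [(ih n).1 k hk]
      · rw [map_smul, map_smul, (ih n).2 k hk, smul_eq_mul, smul_eq_mul]
        ring
  intro m _ s hs
  have h := (hall s (2 * m)).2 m rfl
  rwa [DirectSum.decompose_of_mem_same 𝒜 hs] at h
end

section
/- Let A be a commutative ℂ-algebra with an ℕ-grading 𝒜, let r ≥ 1 be an integer, and let σ ∈ 𝒜 1. Let I = σ·A be the principal ideal generated by σ and let π : A → A/I be the quotient ℂ-algebra homomorphism. If A/I equals the ℂ-subalgebra generated by the image π(⋃_{i=1}^{r} 𝒜 i), then A equals the ℂ-subalgebra generated by ⋃_{i=1}^{r} 𝒜 i. -/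
theorem stmt10_homog (A : Type*) [CommRing A] [Algebra ℂ A]
    (𝒜 : ℕ → Submodule ℂ A) [GradedAlgebra 𝒜] (r : ℕ) (x : A)
    (hx : x ∈ Algebra.adjoin ℂ (⋃ i ∈ Set.Icc 1 r, (𝒜 i : Set A))) :
    ∀ n, (DirectSum.decompose 𝒜 x n : A) ∈
      Algebra.adjoin ℂ (⋃ i ∈ Set.Icc 1 r, (𝒜 i : Set A)) := by
  classical
  induction hx using Algebra.adjoin_induction with
  | mem x hx =>
    intro n
    have hx' := Algebra.subset_adjoin (R := ℂ) hx
    simp only [Set.mem_iUnion] at hx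
    obtain ⟨i, hi, hxi⟩ := hx
    by_cases h : i = n
    · subst h
      rw [DirectSum.decompose_of_mem_same 𝒜 hxi]
      exact hx'
    · rw [DirectSum.decompose_of_mem_ne 𝒜 hxi h]
      exact zero_mem _
  | algebraMap c =>
    intro n
    have hc : algebraMap ℂ A c ∈ 𝒜 0 := SetLike.algebraMap_mem_graded 𝒜 c
    by_cases h : 0 = n
    · subst h
      rw [DirectSum.decompose_of_mem_same 𝒜 hc]
      exact Subalgebra.algebraMap_mem _ c
    · rw [DirectSum.decompose_of_mem_ne 𝒜 hc h]
      exact zero_mem _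
  | add x y _ _ hx hy =>
    intro n
    rw [DirectSum.decompose_add]
    exact add_mem (hx n) (hy n)
  | mul x y _ _ hx hy =>
    intro n
    rw [← GradedRing.proj_apply]
    rw [← DirectSum.sum_support_decompose 𝒜 x, Finset.sum_mul, map_sum]
    refine sum_mem fun i _ => ?_
    rw [GradedRing.proj_apply,
      DirectSum.coe_decompose_mul_of_left_mem 𝒜 n (DirectSum.decompose 𝒜 x i).2]
    split_ifs
    · exact mul_mem (hx i) (hy _)
    · exact zero_mem _

/-- Let `A` be a graded commutative ℂ-algebra, `r ≥ 1`, and `σ` a homogeneous element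
of degree `1`. If the quotient `A / σ·A` is generated, as ℂ-algebra, by the image of
`⋃_{i=1}^{r} 𝒜 i` under the quotient map, then `A` is generated, as ℂ-algebra, by
`⋃_{i=1}^{r} 𝒜 i`. -/
theorem stmt10 (A : Type*) [CommRing A] [Algebra ℂ A]
    (𝒜 : ℕ → Submodule ℂ A) [GradedAlgebra 𝒜]
    (r : ℕ) (hr : 1 ≤ r)
    (σ : A) (hσ : σ ∈ 𝒜 1)
    (hquot : Algebra.adjoin ℂ
        ((Ideal.Quotient.mkₐ ℂ (Ideal.span {σ})) ''
          (⋃ i ∈ Set.Icc 1 r, (𝒜 i : Set A))) = ⊤) :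
    Algebra.adjoin ℂ (⋃ i ∈ Set.Icc 1 r, (𝒜 i : Set A)) = ⊤ := by
  classical
  have hhom := stmt10_homog A 𝒜 r
  have hσS : σ ∈ Algebra.adjoin ℂ (⋃ i ∈ Set.Icc 1 r, (𝒜 i : Set A)) := by
    apply Algebra.subset_adjoin
    simp only [Set.mem_iUnion]
    exact ⟨1, ⟨le_refl _, hr⟩, hσ⟩
  rw [← AlgHom.map_adjoin] at hquot
  generalize Algebra.adjoin ℂ (⋃ i ∈ Set.Icc 1 r, (𝒜 i : Set A)) = S at *
  have key : ∀ n, ∀ a ∈ 𝒜 n, a ∈ S := by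
    intro n
    induction n using Nat.strong_induction_on with
    | _ n ih =>
      intro a ha
      have h1 : Ideal.Quotient.mkₐ ℂ (Ideal.span {σ}) a ∈
          S.map (Ideal.Quotient.mkₐ ℂ (Ideal.span {σ})) := by
        rw [hquot]; trivial
      obtain ⟨s, hs, hsa⟩ := h1
      have h2 : a - s ∈ Ideal.span {σ} := Ideal.Quotient.eq.mp hsa.symm
      obtain ⟨b, hb⟩ := Ideal.mem_span_singleton'.mp h2
      have h3 : a = s + σ * b := by rw [mul_comm, hb]; ring
      have h4 : a = DirectSum.decompose 𝒜 s n + DirectSum.decompose 𝒜 (σ * b) n := by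
        conv_lhs => rw [← DirectSum.decompose_of_mem_same 𝒜 ha, h3, DirectSum.decompose_add]
        rfl
      rw [h4]
      refine add_mem (hhom s hs n) ?_
      rw [DirectSum.coe_decompose_mul_of_left_mem 𝒜 n hσ]
      split_ifs with h
      · exact mul_mem hσS (ih (n - 1) (by omega) _ (DirectSum.decompose 𝒜 b (n - 1)).2)
      · exact zero_mem _
  rw [eq_top_iff]
  intro x _
  rw [← DirectSum.sum_support_decompose 𝒜 x]
  exact sum_mem fun i _ => key i _ (DirectSum.decompose 𝒜 x i).2
end
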